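/- For every δ > 0 there exists t_0 such that for all t > t_0 and all p with 0 < p ≤ 2/(√(4t+9)−1): if G ⊆ 2^{[n]} is a 3-wise t-intersecting family with μ_p(G) ≥ (1/2 + δ) p^t, then G ⊆ F for some F isomorphic to F_0^t = {F : [t] ⊆ F} or to F_1^t = {F : |F ∩ [t+3]| ≥ t+2}. -/

import Mathlib

open Finset

/-- p-biased measure of a family on ground set of size `n` (= `[n]`). -/
def mu (p : ℝ) (n : ℕ) (G : Finset (Finset ℕ)) : ℝ :=
  ∑ A ∈ G, p ^ A.card * (1 - p) ^ (n - A.card)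

/-- p-biased measure of a family on an arbitrary finite ground set `X`. -/
def muOn (p : ℝ) (X : Finset ℕ) (G : Finset (Finset ℕ)) : ℝ :=
  ∑ A ∈ G, p ^ A.card * (1 - p) ^ (X.card - A.card)

/-- `F_0^t = {F ⊆ [n] : [t] ⊆ F}`. -/
def F0 (n t : ℕ) : Finset (Finset ℕ) :=
  (Finset.Icc 1 n).powerset.filter (fun F => Finset.Icc 1 t ⊆ F)

/-- `F_1^t = {F ⊆ [n] : |F ∩ [t+3]| ≥ t+2}`. -/
def F1 (n t : ℕ) : Finset (Finset ℕ) :=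
  (Finset.Icc 1 n).powerset.filter (fun F => t + 2 ≤ (F ∩ Finset.Icc 1 (t + 3)).card)

/-- `F_2^t = {F ⊆ [n] : |F ∩ [t+6]| ≥ t+4}`. -/
def F2 (n t : ℕ) : Finset (Finset ℕ) :=
  (Finset.Icc 1 n).powerset.filter (fun F => t + 4 ≤ (F ∩ Finset.Icc 1 (t + 6)).card)

/-- `p_0(t) = 2/(√(4t+9) − 1)`. -/
noncomputable def p0 (t : ℕ) : ℝ := 2 / (Real.sqrt (4 * t + 9) - 1)

/-- The family is `r`-wise `t`-intersecting: any `r` members (with repetition)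
intersect in at least `t` elements. -/
def RWise (r t : ℕ) (G : Finset (Finset ℕ)) : Prop :=
  ∀ f : Fin r → Finset ℕ, (∀ k, f k ∈ G) → t ≤ (⋂ k, (f k : Set ℕ)).ncard

/-- The shift `s_{i,j}` of a single set `A`, relative to the family `G`. -/
def shiftSet (i j : ℕ) (G : Finset (Finset ℕ)) (A : Finset ℕ) : Finset ℕ :=
  if A ∩ {i, j} = {j} ∧ (A.erase j ∪ {i}) ∉ G then A.erase j ∪ {i} else A

/-- The shifting operation `σ_{i,j}` applied to a family. -/
def shift (i j : ℕ) (G : Finset (Finset ℕ)) : Finset (Finset ℕ) :=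
  G.image (shiftSet i j G)

/-- `G` and `H` are isomorphic as families on ground set `[n]`:
`H` is the image of `G` under a permutation preserving `[n]`. -/
def Iso (n : ℕ) (G H : Finset (Finset ℕ)) : Prop :=
  ∃ τ : Equiv.Perm ℕ, (∀ x, x ∈ Finset.Icc 1 n ↔ τ x ∈ Finset.Icc 1 n) ∧
    H = G.image (fun A => A.image τ)

/-- `G` is `(3,t)`-maximal on `[n]`. -/
def Max3 (n t : ℕ) (G : Finset (Finset ℕ)) : Prop :=
  (∀ A ∈ G, A ⊆ Finset.Icc 1 n) ∧ RWise 3 t G ∧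
    ∀ F : Finset ℕ, F ⊆ Finset.Icc 1 n → F ∉ G → ¬ RWise 3 t (insert F G)

/-- `G` is shifted on `[n]`. -/
def Shifted (n : ℕ) (G : Finset (Finset ℕ)) : Prop :=
  ∀ i j : ℕ, 1 ≤ i → i < j → j ≤ n → shift i j G = G

/-- One shifting step. -/
def ShiftStep (n : ℕ) (G H : Finset (Finset ℕ)) : Prop :=
  ∃ i j : ℕ, 1 ≤ i ∧ i ≤ n ∧ 1 ≤ j ∧ j ≤ n ∧ H = shift i j G

/-! ### Auxiliary expectations -/

noncomputable def EE (p : ℝ) (X : Finset ℕ) (f : Finset ℕ → ℝ) : ℝ :=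
  ∑ A ∈ X.powerset, p ^ A.card * (1 - p) ^ (X.card - A.card) * f A

open Classical in
noncomputable def PP (p : ℝ) (X : Finset ℕ) (P : Finset ℕ → Prop) : ℝ :=
  EE p X (fun A => if P A then 1 else 0)

lemma EE_insert (p : ℝ) (X : Finset ℕ) (a : ℕ) (ha : a ∉ X) (f : Finset ℕ → ℝ) :
    EE p (insert a X) f = p * EE p X (fun A => f (insert a A)) + (1 - p) * EE p X f := by
  unfold EE
  rw [Finset.sum_powerset_insert ha, add_comm, Finset.mul_sum, Finset.mul_sum]
  congr 1
  · refine Finset.sum_congr rfl fun A hA => ?_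
    have hA' := Finset.mem_powerset.1 hA
    have : a ∉ A := fun h => ha (hA' h)
    rw [Finset.card_insert_of_notMem this, Finset.card_insert_of_notMem ha]
    rw [Nat.add_sub_add_right]; ring
  · refine Finset.sum_congr rfl fun A hA => ?_
    have hA' := Finset.card_le_card (Finset.mem_powerset.1 hA)
    rw [Finset.card_insert_of_notMem ha, Nat.sub_add_comm hA']; ring

lemma EE_mono {p : ℝ} (h0 : 0 ≤ p) (h1 : p ≤ 1) (X : Finset ℕ) {f g : Finset ℕ → ℝ}
    (h : ∀ A ⊆ X, f A ≤ g A) : EE p X f ≤ EE p X g := by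
  unfold EE
  refine Finset.sum_le_sum fun A hA => ?_
  have : 0 ≤ 1 - p := by linarith
  have := h A (Finset.mem_powerset.1 hA)
  gcongr

lemma EE_const (p : ℝ) (X : Finset ℕ) (c : ℝ) : EE p X (fun _ => c) = c := by
  induction X using Finset.induction_on with
  | empty => simp [EE]
  | insert a X ha ih => rw [EE_insert _ _ _ ha, ih]; ring

lemma EE_union (p : ℝ) (S Y : Finset ℕ) (h : Disjoint S Y) (f : Finset ℕ → ℝ) :
    EE p (S ∪ Y) f = EE p S (fun T => EE p Y (fun B => f (T ∪ B))) := by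
  induction S using Finset.induction_on generalizing f with
  | empty => simp [EE]
  | insert a S ha ih =>
    rw [Finset.disjoint_insert_left] at h
    have : a ∉ S ∪ Y := by simp [ha, h.1]
    rw [Finset.insert_union, EE_insert _ _ _ this, EE_insert _ _ _ ha, ih h.2, ih h.2]
    simp only [Finset.insert_union]

lemma PP_nonneg {p : ℝ} (h0 : 0 ≤ p) (h1 : p ≤ 1) (X : Finset ℕ) (P : Finset ℕ → Prop) :
    0 ≤ PP p X P := by
  rw [← EE_const p X 0]
  exact EE_mono h0 h1 X fun A _ => by split_ifs <;> norm_num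

lemma PP_mono {p : ℝ} (h0 : 0 ≤ p) (h1 : p ≤ 1) (X : Finset ℕ) {P Q : Finset ℕ → Prop}
    (h : ∀ A ⊆ X, P A → Q A) : PP p X P ≤ PP p X Q := by
  refine EE_mono h0 h1 X fun A hA => ?_
  have := h A hA
  split_ifs <;> first | tauto | norm_num

lemma PP_le_one {p : ℝ} (h0 : 0 ≤ p) (h1 : p ≤ 1) (X : Finset ℕ) (P : Finset ℕ → Prop) :
    PP p X P ≤ 1 := by
  conv_rhs => rw [← EE_const p X 1]
  exact EE_mono h0 h1 X fun A _ => by split_ifs <;> norm_num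

lemma PP_eq_zero {p : ℝ} (X : Finset ℕ) (P : Finset ℕ → Prop) (h : ∀ A ⊆ X, ¬ P A) :
    PP p X P = 0 := by
  unfold PP EE
  refine Finset.sum_eq_zero fun A hA => ?_
  simp [h A (Finset.mem_powerset.1 hA)]

lemma PP_insert (p : ℝ) (X : Finset ℕ) (a : ℕ) (ha : a ∉ X) (P : Finset ℕ → Prop) :
    PP p (insert a X) P = p * PP p X (fun A => P (insert a A)) + (1 - p) * PP p X P :=
  EE_insert p X a ha _

lemma cross_alg {p x1 x2 y1 y2 R : ℝ} (h0 : 0 < p) (h1 : p ≤ 1 / 2)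
    (hy1 : 0 ≤ y1) (hy2 : 0 ≤ y2) (hx1 : y1 ≤ x1) (hx2 : y2 ≤ x2)
    (hP : p ^ 2 * (x1 * x2) ≤ (1 - p) ^ 2 * R) (h12 : x1 * y2 ≤ R) (h21 : y1 * x2 ≤ R) :
    (p * x1 + (1 - p) * y1) * (p * x2 + (1 - p) * y2) ≤ R := by
  have hR : 0 ≤ R := le_trans (mul_nonneg (hy1.trans hx1) hy2) h12
  have hq : 0 ≤ 1 - p := by linarith
  by_cases hc : x1 * x2 ≤ R
  · refine le_trans (mul_le_mul (b := x1) (d := x2) ?_ ?_ ?_ ?_) hc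
    · nlinarith
    · nlinarith
    · have := hy2.trans hx2; positivity
    · linarith
  · push Not at hc
    set P := x1 * x2 with hPdef
    have hPpos : 0 < P := lt_of_le_of_lt hR hc
    have hyy : P * (y1 * y2) ≤ R ^ 2 := by
      have : (x1 * y2) * (y1 * x2) ≤ R * R :=
        mul_le_mul h12 h21 (mul_nonneg hy1 (hy2.trans hx2)) hR
      rw [hPdef]; nlinarith
    have key : P * ((p * x1 + (1 - p) * y1) * (p * x2 + (1 - p) * y2)) ≤ P * R := by
      have e : P * ((p * x1 + (1 - p) * y1) * (p * x2 + (1 - p) * y2))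
        = p ^ 2 * P ^ 2 + p * (1 - p) * P * (x1 * y2 + y1 * x2)
          + (1 - p) ^ 2 * (P * (y1 * y2)) := by rw [hPdef]; ring
      rw [e]
      have a1 : p * (1 - p) * P * (x1 * y2 + y1 * x2) ≤ p * (1 - p) * P * (2 * R) := by
        apply mul_le_mul_of_nonneg_left (by linarith)
        positivity
      have a2 : (1 - p) ^ 2 * (P * (y1 * y2)) ≤ (1 - p) ^ 2 * R ^ 2 :=
        mul_le_mul_of_nonneg_left hyy (by positivity)
      have a3 : 0 ≤ (P - R) * ((1 - p) ^ 2 * R - p ^ 2 * P) :=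
        mul_nonneg (by linarith) (by linarith)
      nlinarith
    exact le_of_mul_le_mul_left key hPpos

lemma cross2 {p : ℝ} (h0 : 0 < p) (h1 : p ≤ 1 / 2) (X : Finset ℕ) :
    ∀ (m : ℕ) (P Q : Finset ℕ → Prop),
      (∀ A ⊆ X, ∀ B ⊆ X, P A → Q B → m ≤ (A ∩ B).card) →
      PP p X P * PP p X Q ≤ (p / (1 - p)) ^ (2 * m) := by
  have hp1 : p ≤ 1 := by linarith
  have hq : 0 < 1 - p := by linarith
  induction X using Finset.induction_on with
  | empty =>
    intro m P Q h
    rcases Nat.eq_zero_or_pos m with rfl | hm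
    · simpa using mul_le_one₀ (PP_le_one h0.le hp1 _ P) (PP_nonneg h0.le hp1 _ Q)
        (PP_le_one h0.le hp1 _ Q)
    · by_cases hP : P ∅
      · rw [PP_eq_zero ∅ Q, mul_zero]
        · positivity
        · intro B hB hQ
          have := h ∅ (by simp) B hB hP hQ
          simp at this; omega
      · rw [PP_eq_zero ∅ P, zero_mul]
        · positivity
        · intro B hB hQ
          rw [Finset.subset_empty.1 hB] at hQ; exact hP hQ
  | insert a X ha ih =>
    intro m P Q h
    rcases Nat.eq_zero_or_pos m with rfl | hm
    · simpa using mul_le_one₀ (PP_le_one h0.le hp1 _ P) (PP_nonneg h0.le hp1 _ Q)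
        (PP_le_one h0.le hp1 _ Q)
    obtain ⟨m, rfl⟩ : ∃ k, m = k + 1 := ⟨m - 1, by omega⟩
    have key : ∀ A ⊆ X, ∀ B ⊆ X, (P (insert a A) ∨ P A) → (Q (insert a B) ∨ Q B) →
        m ≤ (A ∩ B).card := by
      intro A hA B hB hPA hQB
      obtain ⟨A', hA', hPA', hA's⟩ : ∃ A', A' ⊆ insert a X ∧ P A' ∧ A' ⊆ insert a A := by
        rcases hPA with h | h
        · exact ⟨_, Finset.insert_subset_insert _ hA, h, subset_rfl⟩
        · exact ⟨A, hA.trans (Finset.subset_insert _ _), h, Finset.subset_insert _ _⟩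
      obtain ⟨B', hB', hQB', hB's⟩ : ∃ A', A' ⊆ insert a X ∧ Q A' ∧ A' ⊆ insert a B := by
        rcases hQB with h | h
        · exact ⟨_, Finset.insert_subset_insert _ hB, h, subset_rfl⟩
        · exact ⟨B, hB.trans (Finset.subset_insert _ _), h, Finset.subset_insert _ _⟩
      have h2 := h A' hA' B' hB' hPA' hQB'
      have h3 : A' ∩ B' ⊆ insert a (A ∩ B) := by
        rw [Finset.insert_inter_distrib]; exact Finset.inter_subset_inter hA's hB's
      have := Finset.card_le_card h3
      have := Finset.card_insert_le a (A ∩ B)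
      omega
    have key1 : ∀ A ⊆ X, ∀ B ⊆ X, (P (insert a A) ∨ P A) → Q B →
        m + 1 ≤ (A ∩ B).card := by
      intro A hA B hB hPA hQB
      have haB : a ∉ B := fun h => ha (hB h)
      rcases hPA with h' | h'
      · have := h _ (Finset.insert_subset_insert _ hA) B (hB.trans (Finset.subset_insert _ _)) h' hQB
        rwa [Finset.insert_inter_of_notMem haB] at this
      · exact h A (hA.trans (Finset.subset_insert _ _)) B (hB.trans (Finset.subset_insert _ _)) h' hQB
    have key2 : ∀ A ⊆ X, ∀ B ⊆ X, P A → (Q (insert a B) ∨ Q B) →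
        m + 1 ≤ (A ∩ B).card := by
      intro A hA B hB hPA hQB
      have haA : a ∉ A := fun h => ha (hA h)
      rcases hQB with h' | h'
      · have := h A (hA.trans (Finset.subset_insert _ _)) _ (Finset.insert_subset_insert _ hB) hPA h'
        rwa [Finset.inter_insert_of_notMem haA] at this
      · exact h A (hA.trans (Finset.subset_insert _ _)) B (hB.trans (Finset.subset_insert _ _)) hPA h'
    have b0 := ih m _ _ key
    have b1 := ih (m + 1) _ _ key1
    have b2 := ih (m + 1) _ _ key2
    rw [PP_insert _ _ _ ha, PP_insert _ _ _ ha]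
    have e1 : PP p X (fun A => P (insert a A)) ≤ PP p X (fun A => P (insert a A) ∨ P A) :=
      PP_mono h0.le hp1 X fun A _ h => Or.inl h
    have e2 : PP p X (fun A => Q (insert a A)) ≤ PP p X (fun A => Q (insert a A) ∨ Q A) :=
      PP_mono h0.le hp1 X fun A _ h => Or.inl h
    have f1 : PP p X P ≤ PP p X (fun A => P (insert a A) ∨ P A) :=
      PP_mono h0.le hp1 X fun A _ h => Or.inr h
    have f2 : PP p X Q ≤ PP p X (fun A => Q (insert a A) ∨ Q A) :=
      PP_mono h0.le hp1 X fun A _ h => Or.inr h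
    have nP := PP_nonneg h0.le hp1 X P
    have nQ := PP_nonneg h0.le hp1 X Q
    have nP' := PP_nonneg h0.le hp1 X (fun A => P (insert a A))
    have nQ' := PP_nonneg h0.le hp1 X (fun A => Q (insert a A))
    refine le_trans ?_ (cross_alg h0 h1 nP nQ f1 f2 ?_ b1 b2)
    · apply mul_le_mul
      · gcongr
      · gcongr
      · positivity
      · have := nP'.trans e1
        positivity
    · have e : (1 - p) ^ 2 * (p / (1 - p)) ^ (2 * (m + 1)) = p ^ 2 * (p / (1 - p)) ^ (2 * m) := by
        rw [show 2 * (m + 1) = 2 * m + 2 by ring, pow_add, div_pow p (1 - p) 2]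
        field_simp
      rw [e]
      gcongr
/-! ### Analytic part -/

noncomputable def TT (j : ℕ) (p y : ℝ) : ℝ :=
  ∑ k ∈ Finset.range (j + 1), p ^ (j - k) *
    ∑ r ∈ Finset.range (k + 1), (k.choose r : ℝ) * p ^ r * (y ^ (k - r) / ((k - r).factorial : ℝ))

lemma TT_mono (j : ℕ) {p y z : ℝ} (hp : 0 ≤ p) (hy : 0 ≤ y) (hyz : y ≤ z) :
    TT j p y ≤ TT j p z := by
  unfold TT
  gcongr

lemma TT_cont (j : ℕ) : Continuous (fun x : ℝ => TT j x (1 + x)) := by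
  unfold TT
  fun_prop

lemma TT_zero (j : ℕ) : TT j 0 1 = 1 / (j.factorial : ℝ) := by
  unfold TT
  rw [Finset.sum_eq_single j]
  · rw [Finset.sum_eq_single 0]
    · simp
    · intro b _ hb; simp [hb]
    · simp
  · intro b hb hbj
    have : j - b ≠ 0 := by simp at hb; omega
    simp [this]
  · simp

lemma TT_mono_p (j : ℕ) {p p' y : ℝ} (hp : 0 ≤ p) (hy : 0 ≤ y) (h : p ≤ p') :
    TT j p y ≤ TT j p' y := by
  have hp' : 0 ≤ p' := hp.trans h
  unfold TT
  gcongr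

lemma TT_big (j : ℕ) {p y : ℝ} (hp : 0 ≤ p) (hp' : p ≤ 1 / 16) (hy : 0 ≤ y)
    (hy' : y ≤ 2 + 2 * (j * p ^ 2)) : TT j p y ≤ Real.exp 32 / 2 ^ j := by
  have h1 : TT j p y ≤ ∑ k ∈ Finset.range (j + 1), (1 / 8 : ℝ) ^ j * Real.exp (16 * y) := by
    unfold TT
    refine Finset.sum_le_sum fun k hk => ?_
    have hk' : k ≤ j := by simp at hk; omega
    have h2 : ∑ r ∈ Finset.range (k + 1),
        (k.choose r : ℝ) * p ^ r * (y ^ (k - r) / ((k - r).factorial : ℝ))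
        ≤ (p + 1 / 16) ^ k * Real.exp (16 * y) := by
      rw [add_pow, Finset.sum_mul]
      refine Finset.sum_le_sum fun r hr => ?_
      have h3 := Real.pow_div_factorial_le_exp (16 * y) (by positivity) (k - r)
      have h4 : y ^ (k - r) / ((k - r).factorial : ℝ)
          = (1 / 16) ^ (k - r) * ((16 * y) ^ (k - r) / ((k - r).factorial : ℝ)) := by
        rw [mul_pow, one_div, inv_pow]; field_simp
      rw [h4]
      calc _ ≤ (k.choose r : ℝ) * p ^ r * ((1 / 16) ^ (k - r) * Real.exp (16 * y)) := by gcongr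
        _ = _ := by ring
    calc _ ≤ p ^ (j - k) * ((p + 1 / 16) ^ k * Real.exp (16 * y)) := by gcongr
      _ ≤ (1 / 8) ^ (j - k) * ((1 / 8) ^ k * Real.exp (16 * y)) := by
          gcongr <;> linarith
      _ = _ := by rw [← mul_assoc, ← pow_add, Nat.sub_add_cancel hk']
  refine h1.trans ?_
  rw [Finset.sum_const, Finset.card_range, nsmul_eq_mul]
  have h5 : ((j + 1 : ℕ) : ℝ) ≤ 2 ^ j := by
    exact_mod_cast Nat.lt_two_pow_self (n := j)
  have h6 : Real.exp (16 * y) ≤ Real.exp 32 * 2 ^ j := by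
    have e1 : Real.exp (16 * y) ≤ Real.exp (32 + j * (1 / 8)) := by
      apply Real.exp_le_exp.2
      have : p ^ 2 ≤ 1 / 256 := by nlinarith
      have hj : (0 : ℝ) ≤ j := by positivity
      nlinarith
    refine e1.trans ?_
    rw [Real.exp_add, Real.exp_nat_mul]
    have : Real.exp (1 / 8) ≤ 2 := by
      have := Real.exp_one_lt_d9
      have h8 : Real.exp (1 / 8) ^ 8 = Real.exp 1 := by
        rw [← Real.exp_nat_mul]; norm_num
      by_contra hc
      push Not at hc
      have := pow_lt_pow_left₀ hc (by norm_num) (n := 8) (by norm_num)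
      norm_num at this; linarith
    gcongr
  calc ((j + 1 : ℕ) : ℝ) * ((1 / 8) ^ j * Real.exp (16 * y))
      ≤ 2 ^ j * ((1 / 8) ^ j * (Real.exp 32 * 2 ^ j)) := by gcongr
    _ = Real.exp 32 * (2 * (1 / 8) * 2) ^ j := by rw [mul_pow, mul_pow]; ring
    _ = _ := by rw [show (2 * (1 / 8) * 2 : ℝ) = 1 / 2 by norm_num, one_div, inv_pow]; rfl

lemma TT_bound (δ : ℝ) (hδ : 0 < δ) : ∃ ε : ℝ, 0 < ε ∧ ε ≤ 1 / 100 ∧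
    ∀ p : ℝ, 0 < p → p ≤ ε → ∀ j t : ℕ, 2 ≤ j → (t : ℝ) * p ^ 2 ≤ 1 + ε →
      TT j p (((t + j : ℕ) : ℝ) * (p * (p / (1 - p)))) < 1 / 2 + δ := by
  obtain ⟨J, hJ⟩ : ∃ J : ℕ, Real.exp 32 * 2 < 2 ^ J := pow_unbounded_of_one_lt _ (by norm_num)
  have h1 : ∀ᶠ x : ℝ in nhds 0, ∀ j ∈ Finset.range J, 2 ≤ j → TT j x (1 + x) < 1 / 2 + δ := by
    rw [Filter.eventually_all_finset]
    intro j _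
    by_cases hj : 2 ≤ j
    · have hc := (TT_cont j).tendsto 0
      have : TT j 0 (1 + 0) < 1 / 2 + δ := by
        rw [add_zero, TT_zero]
        have : (2 : ℝ) ≤ (j.factorial : ℝ) := by
          exact_mod_cast (hj.trans (Nat.self_le_factorial j))
        have : 1 / (j.factorial : ℝ) ≤ 1 / 2 := by gcongr
        linarith
      filter_upwards [hc.eventually (gt_mem_nhds this)] with x hx _ using hx
    · exact Filter.Eventually.of_forall fun x h => absurd h hj
  obtain ⟨η, hη, hb⟩ := Metric.eventually_nhds_iff.1 h1
  set θ := min (η / 2) 1 with hθ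
  have hθ0 : 0 < θ := by positivity
  have hθ1 : θ ≤ 1 := min_le_right _ _
  have hθη : θ < η := lt_of_le_of_lt (min_le_left _ _) (by linarith)
  have hbθ := hb (y := θ) (by rw [Real.dist_eq, sub_zero, abs_of_pos hθ0]; exact hθη)
  refine ⟨θ / (J + 100), by positivity, ?_, ?_⟩
  · rw [div_le_div_iff₀ (by positivity) (by norm_num)]
    have : (0 : ℝ) ≤ J := by positivity
    nlinarith
  intro p hp hpe j t hj htp
  have hJ0 : (0 : ℝ) ≤ J := by positivity
  set ε := θ / (J + 100) with hε
  have hεθ : ε * (J + 100) = θ := by rw [hε]; field_simp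
  have hε0 : 0 < ε := by positivity
  have hε1 : ε ≤ 1 / 100 := by nlinarith
  have hq : 0 < 1 - p := by linarith
  have hy0 : 0 ≤ ((t + j : ℕ) : ℝ) * (p * (p / (1 - p))) := by positivity
  have hyeq : ((t + j : ℕ) : ℝ) * (p * (p / (1 - p))) = (t * p ^ 2 + j * p ^ 2) / (1 - p) := by
    push_cast; field_simp
  by_cases hjJ : j < J
  · refine lt_of_le_of_lt ?_ (hbθ j (Finset.mem_range.2 hjJ) hj)
    refine (TT_mono j hp.le hy0 (z := 1 + θ) ?_).trans (TT_mono_p j hp.le (by positivity) ?_)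
    · rw [hyeq, div_le_iff₀ hq]
      have hjJ' : (j : ℝ) ≤ J := by exact_mod_cast hjJ.le
      have : (j : ℝ) * p ^ 2 ≤ J * ε := by
        apply mul_le_mul hjJ' _ (by positivity) hJ0
        nlinarith
      nlinarith
    · nlinarith
  · push Not at hjJ
    have hb2 := TT_big j hp.le (by linarith) hy0 (by
      rw [hyeq, div_le_iff₀ hq]
      have : (0 : ℝ) ≤ j * p ^ 2 := by positivity
      nlinarith)
    refine lt_of_le_of_lt hb2 ?_
    have : (2 : ℝ) ^ J ≤ 2 ^ j := pow_le_pow_right₀ (by norm_num) hjJ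
    rw [div_lt_iff₀ (by positivity)]
    have : 0 < δ * 2 ^ j := by positivity
    nlinarith
/-! ### Combinatorial part -/

lemma level_bound (S : Finset ℕ) (k : ℕ) (β : ℝ) (hβ : 0 ≤ β) (x : Finset ℕ → ℝ)
    (hx : ∀ K, 0 ≤ x K)
    (hxx : ∀ K ⊆ S, ∀ K' ⊆ S, x K * x K' ≤ β ^ (2 * (K ∪ K').card)) :
    ∑ K ∈ Finset.powersetCard k S, x K ≤
      ∑ r ∈ Finset.range (k + 1), (k.choose r : ℝ) * (S.card.choose (k - r) : ℝ) * β ^ (2 * k - r) := by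
  rcases (Finset.powersetCard k S).eq_empty_or_nonempty with he | hne
  · rw [he, Finset.sum_empty]; positivity
  obtain ⟨K0, hK0, hmax⟩ := Finset.exists_max_image _ x hne
  obtain ⟨hK0S, hK0c⟩ := Finset.mem_powersetCard.1 hK0
  have h1 : ∀ K ∈ Finset.powersetCard k S, x K ≤ β ^ (K ∪ K0).card := by
    intro K hK
    have hKS := (Finset.mem_powersetCard.1 hK).1
    have h2 : x K ^ 2 ≤ (β ^ (K ∪ K0).card) ^ 2 := by
      rw [← pow_mul, mul_comm _ 2]
      refine le_trans ?_ (hxx K hKS K0 hK0S)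
      rw [sq]
      exact mul_le_mul_of_nonneg_left (hmax K hK) (hx K)
    exact (pow_le_pow_iff_left₀ (hx K) (by positivity) (by norm_num)).1 h2
  refine (Finset.sum_le_sum h1).trans ?_
  rw [← Finset.sum_fiberwise_of_maps_to (t := K0.powerset) (g := fun K => K ∩ K0)
    (fun K _ => by simp)]
  have h3 : ∀ R ∈ K0.powerset, ∑ K ∈ Finset.powersetCard k S with K ∩ K0 = R, β ^ (K ∪ K0).card
      ≤ (S.card.choose (k - R.card) : ℝ) * β ^ (2 * k - R.card) := by
    intro R hR
    have hc : ∀ K ∈ (Finset.powersetCard k S).filter (fun K => K ∩ K0 = R),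
        K ⊆ S ∧ (K ∪ K0).card = 2 * k - R.card ∧ (K \ K0).card = k - R.card := by
      intro K hK
      obtain ⟨hK1, hK2⟩ := Finset.mem_filter.1 hK
      obtain ⟨hK3, hK4⟩ := Finset.mem_powersetCard.1 hK1
      have e1 := Finset.card_union_add_card_inter K K0
      have e2 := Finset.card_sdiff_add_card_inter K K0
      rw [hK2] at e1 e2
      exact ⟨hK3, by omega, by omega⟩
    have hle : ((Finset.powersetCard k S).filter (fun K => K ∩ K0 = R)).card
        ≤ S.card.choose (k - R.card) := by
      rw [← Finset.card_powersetCard]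
      refine Finset.card_le_card_of_injOn (fun K => K \ K0) ?_ ?_
      · intro K hK
        have := hc K hK
        exact Finset.mem_coe.2 (Finset.mem_powersetCard.2
          ⟨Finset.sdiff_subset.trans this.1, this.2.2⟩)
      · intro K hK K' hK' heq
        have a1 := (Finset.mem_filter.1 hK).2
        have a2 := (Finset.mem_filter.1 hK').2
        rw [← Finset.sdiff_union_inter K K0, ← Finset.sdiff_union_inter K' K0, a1, a2]
        simp only at heq
        rw [heq]
    rw [Finset.sum_congr rfl (fun K hK => by rw [(hc K hK).2.1]), Finset.sum_const, nsmul_eq_mul]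
    have : (((Finset.powersetCard k S).filter (fun K => K ∩ K0 = R)).card : ℝ)
        ≤ (S.card.choose (k - R.card) : ℝ) := by exact_mod_cast hle
    gcongr
  refine (Finset.sum_le_sum h3).trans (le_of_eq ?_)
  rw [Finset.sum_powerset_apply_card
    (fun r => (S.card.choose (k - r) : ℝ) * β ^ (2 * k - r)) , hK0c]
  refine Finset.sum_congr rfl fun r _ => ?_
  rw [nsmul_eq_mul]; ring

noncomputable def hh (p : ℝ) (n : ℕ) (G : Finset (Finset ℕ)) (S K : Finset ℕ) : ℝ :=
  PP p (Finset.Icc 1 n \ S) (fun B => (S \ K) ∪ B ∈ G)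

lemma mu_decomp (p : ℝ) (n : ℕ) (G : Finset (Finset ℕ)) (hG : ∀ A ∈ G, A ⊆ Finset.Icc 1 n)
    (S : Finset ℕ) (hS : S ⊆ Finset.Icc 1 n) :
    mu p n G = ∑ K ∈ S.powerset, p ^ (S.card - K.card) * (1 - p) ^ K.card * hh p n G S K := by
  classical
  have h1 : mu p n G = PP p (Finset.Icc 1 n) (fun A => A ∈ G) := by
    unfold mu PP EE
    simp only [mul_ite, mul_one, mul_zero]
    rw [← Finset.sum_filter, Nat.card_Icc]
    have : (Finset.Icc 1 n).powerset.filter (fun A => A ∈ G) = G := by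
      ext A; simp only [Finset.mem_filter, Finset.mem_powerset]
      exact ⟨fun h => h.2, fun h => ⟨hG A h, h⟩⟩
    rw [this]; rfl
  have h2 : PP p (Finset.Icc 1 n) (fun A => A ∈ G)
      = EE p S (fun T => PP p (Finset.Icc 1 n \ S) (fun B => T ∪ B ∈ G)) := by
    have := EE_union p S (Finset.Icc 1 n \ S) Finset.disjoint_sdiff
      (fun A => @ite ℝ (A ∈ G) (Classical.propDecidable _) 1 0)
    rw [Finset.union_sdiff_of_subset hS] at this
    exact this
  rw [h1, h2]
  unfold EE hh
  refine Finset.sum_nbij' (fun T => S \ T) (fun T => S \ T) ?_ ?_ ?_ ?_ ?_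
  · intro T _; simp
  · intro T _; simp
  · intro T hT; simpa using Finset.mem_powerset.1 hT
  · intro T hT; simpa using Finset.mem_powerset.1 hT
  · intro T hT
    have hT' := Finset.mem_powerset.1 hT
    have hc := Finset.card_le_card hT'
    simp only
    rw [Finset.card_sdiff_of_subset hT', Finset.sdiff_sdiff_eq_self hT', Nat.sub_sub_self hc]

lemma hh_cross {p : ℝ} (h0 : 0 < p) (h1 : p ≤ 1 / 2) (n : ℕ) (G : Finset (Finset ℕ))
    (S K K' : Finset ℕ) (m : ℕ)
    (h : ∀ C ∈ G, ∀ C' ∈ G, C ∩ S = S \ K → C' ∩ S = S \ K' → m ≤ ((C ∩ C') \ S).card) :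
    hh p n G S K * hh p n G S K' ≤ (p / (1 - p)) ^ (2 * m) := by
  refine cross2 h0 h1 _ m _ _ ?_
  intro A hA B hB hAG hBG
  have dA : ∀ x ∈ A, x ∉ S := fun x hx => (Finset.mem_sdiff.1 (hA hx)).2
  have dB : ∀ x ∈ B, x ∉ S := fun x hx => (Finset.mem_sdiff.1 (hB hx)).2
  have := h _ hAG _ hBG (by ext x; have := dA x; simp; tauto) (by ext x; have := dB x; simp; tauto)
  refine this.trans (Finset.card_le_card ?_)
  intro x hx
  simp at hx ⊢
  tauto

lemma hh_zero {p : ℝ} (n : ℕ) (G : Finset (Finset ℕ)) (S K : Finset ℕ)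
    (h : ∀ C ∈ G, C ∩ S ≠ S \ K) : hh p n G S K = 0 := by
  refine PP_eq_zero _ _ fun B hB hBG => h _ hBG ?_
  have dB : ∀ x ∈ B, x ∉ S := fun x hx => (Finset.mem_sdiff.1 (hB hx)).2
  ext x; have := dB x; simp; tauto

lemma hh_cross_gen {p : ℝ} (h0 : 0 < p) (h1 : p ≤ 1 / 2) (n : ℕ) (G : Finset (Finset ℕ))
    (S : Finset ℕ) (hint : ∀ C ∈ G, ∀ C' ∈ G, S.card ≤ (C ∩ C').card)
    (K : Finset ℕ) (hK : K ⊆ S) (K' : Finset ℕ) (hK' : K' ⊆ S) :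
    hh p n G S K * hh p n G S K' ≤ (p / (1 - p)) ^ (2 * (K ∪ K').card) := by
  refine hh_cross h0 h1 n G S K K' _ ?_
  intro C hC C' hC' e e'
  have h2 := hint C hC C' hC'
  have h3 := Finset.card_sdiff_add_card_inter (C ∩ C') S
  have h4 : C ∩ C' ∩ S = S \ (K ∪ K') := by
    ext x
    have a := Finset.ext_iff.1 e x
    have b := Finset.ext_iff.1 e' x
    simp at a b ⊢; tauto
  rw [h4, Finset.card_sdiff_of_subset (Finset.union_subset hK hK')] at h3
  have := Finset.card_le_card (Finset.union_subset hK hK')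
  omega

lemma mu_le_TT {p : ℝ} (h0 : 0 < p) (h1 : p ≤ 1 / 2) (n t j : ℕ) (G : Finset (Finset ℕ))
    (hG : ∀ A ∈ G, A ⊆ Finset.Icc 1 n)
    (S : Finset ℕ) (hS : S ⊆ Finset.Icc 1 n) (hSc : S.card = t + j)
    (hint : ∀ C ∈ G, ∀ C' ∈ G, S.card ≤ (C ∩ C').card)
    (hCS : ∀ C ∈ G, t ≤ (C ∩ S).card) :
    mu p n G ≤ p ^ t * TT j p (((t + j : ℕ) : ℝ) * (p * (p / (1 - p)))) := by
  have hq : 0 < 1 - p := by linarith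
  rw [mu_decomp p n G hG S hS, Finset.sum_powerset]
  rw [← Finset.sum_subset (s₁ := Finset.range (j + 1))]
  rotate_left
  · intro k; simp; omega
  · intro k _ hk
    refine Finset.sum_eq_zero fun K hK => ?_
    obtain ⟨hK1, hK2⟩ := Finset.mem_powersetCard.1 hK
    rw [hh_zero, mul_zero]
    intro C hC e
    have := hCS C hC
    rw [e, Finset.card_sdiff_of_subset hK1] at this
    simp at hk
    have := Finset.card_le_card hK1
    omega
  unfold TT
  rw [Finset.mul_sum]
  refine Finset.sum_le_sum fun k hk => ?_
  have hkj : k ≤ j := by simp at hk; omega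
  have e1 : ∑ K ∈ Finset.powersetCard k S, p ^ (S.card - K.card) * (1 - p) ^ K.card * hh p n G S K
      = p ^ (S.card - k) * (1 - p) ^ k * ∑ K ∈ Finset.powersetCard k S, hh p n G S K := by
    rw [Finset.mul_sum]
    refine Finset.sum_congr rfl fun K hK => ?_
    rw [(Finset.mem_powersetCard.1 hK).2]
  rw [e1]
  have hlb := level_bound S k (p / (1 - p)) (by positivity) (hh p n G S)
    (fun K => PP_nonneg h0.le (by linarith) _ _) (hh_cross_gen h0 h1 n G S hint)
  refine (mul_le_mul_of_nonneg_left hlb (by positivity)).trans ?_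
  rw [show S.card - k = t + (j - k) by omega, pow_add]
  simp only [mul_assoc]
  refine mul_le_mul_of_nonneg_left ?_ (by positivity)
  refine mul_le_mul_of_nonneg_left ?_ (by positivity)
  rw [Finset.mul_sum]
  refine Finset.sum_le_sum fun r hr => ?_
  have hrk : r ≤ k := by simp at hr; omega
  have e2 : (1 - p) ^ k * (p / (1 - p)) ^ (2 * k - r)
      = p ^ r * (p * (p / (1 - p))) ^ (k - r) := by
    obtain ⟨i, rfl⟩ := Nat.exists_eq_add_of_le hrk
    rw [show 2 * (r + i) - r = (r + i) + i by omega, show r + i - r = i by omega,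
      pow_add _ (r + i) i, ← mul_assoc, ← mul_pow, mul_div_cancel₀ _ hq.ne', mul_pow, pow_add]
    ring
  have e3 : (S.card.choose (k - r) : ℝ) ≤ ((t + j : ℕ) : ℝ) ^ (k - r) / ((k - r).factorial : ℝ) := by
    rw [hSc]; exact Nat.choose_le_pow_div _ _
  calc _ = (k.choose r : ℝ) * (S.card.choose (k - r) : ℝ)
        * ((1 - p) ^ k * (p / (1 - p)) ^ (2 * k - r)) := by ring
    _ = (k.choose r : ℝ) * (S.card.choose (k - r) : ℝ)
        * (p ^ r * (p * (p / (1 - p))) ^ (k - r)) := by rw [e2]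
    _ ≤ (k.choose r : ℝ) * (((t + j : ℕ) : ℝ) ^ (k - r) / ((k - r).factorial : ℝ))
        * (p ^ r * (p * (p / (1 - p))) ^ (k - r)) := by gcongr
    _ = _ := by
      simp only [mul_pow]; ring
/-! ### Isomorphisms -/

lemma exists_perm (n c : ℕ) (W : Finset ℕ) (hW : W ⊆ Finset.Icc 1 n) (hc : W.card = c) :
    ∃ τ : Equiv.Perm ℕ, (∀ x, x ∈ Finset.Icc 1 n ↔ τ x ∈ Finset.Icc 1 n) ∧
      ∀ x, x ∈ Finset.Icc 1 c ↔ τ x ∈ W := by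
  classical
  have hcn : c ≤ n := by
    have := Finset.card_le_card hW
    simp at this; omega
  have hV : Finset.Icc 1 c ⊆ Finset.Icc 1 n := Finset.Icc_subset_Icc le_rfl hcn
  have e0 : {x : {x // x ∈ Finset.Icc 1 n} // x.1 ∈ Finset.Icc 1 c}
      ≃ {x : {x // x ∈ Finset.Icc 1 n} // x.1 ∈ W} :=
    ((Equiv.subtypeSubtypeEquivSubtype (fun {x} h => hV h)).trans
      (Finset.equivOfCardEq (by rw [hc]; simp))).trans
      (Equiv.subtypeSubtypeEquivSubtype (fun {x} h => hW h)).symm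
  let σ := e0.extendSubtype
  refine ⟨Equiv.Perm.ofSubtype σ, ?_, ?_⟩
  · intro x
    by_cases hx : x ∈ Finset.Icc 1 n
    · rw [Equiv.Perm.ofSubtype_apply_of_mem σ hx]
      exact ⟨fun _ => (σ ⟨x, hx⟩).2, fun _ => hx⟩
    · rw [Equiv.Perm.ofSubtype_apply_of_not_mem σ hx]
  · intro x
    by_cases hx : x ∈ Finset.Icc 1 n
    · rw [Equiv.Perm.ofSubtype_apply_of_mem σ hx]
      constructor
      · intro h
        exact e0.extendSubtype_mem ⟨x, hx⟩ h
      · intro h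
        by_contra hn
        exact e0.extendSubtype_not_mem ⟨x, hx⟩ hn h
    · have h1 : x ∉ Finset.Icc 1 c := fun h => hx (hV h)
      rw [Equiv.Perm.ofSubtype_apply_of_not_mem σ hx]
      exact ⟨fun h => absurd h h1, fun h => absurd (hW h) hx⟩

lemma iso_cover (n : ℕ) (G : Finset (Finset ℕ)) (hG : ∀ A ∈ G, A ⊆ Finset.Icc 1 n)
    (W : Finset ℕ) (hW : W ⊆ Finset.Icc 1 n) (a : ℕ) (h : ∀ D ∈ G, a ≤ (D ∩ W).card) :
    ∃ F, Iso n ((Finset.Icc 1 n).powerset.filter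
      (fun F => a ≤ (F ∩ Finset.Icc 1 W.card).card)) F ∧ G ⊆ F := by
  obtain ⟨τ, h1, h2⟩ := exists_perm n W.card W hW rfl
  refine ⟨_, ⟨τ, h1, rfl⟩, ?_⟩
  intro D hD
  refine Finset.mem_image.2 ⟨D.image τ.symm, ?_, ?_⟩
  · refine Finset.mem_filter.2 ⟨Finset.mem_powerset.2 ?_, ?_⟩
    · intro x hx
      obtain ⟨y, hy, rfl⟩ := Finset.mem_image.1 hx
      rw [h1]; simpa using hG D hD hy
    · refine (h D hD).trans ?_
      have : D.image τ.symm ∩ Finset.Icc 1 W.card = (D ∩ W).image τ.symm := by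
        ext x
        rw [Finset.mem_inter, h2]
        simp only [Finset.mem_image, Finset.mem_inter]
        constructor
        · rintro ⟨⟨y, hy, rfl⟩, h⟩
          exact ⟨y, ⟨hy, by simpa using h⟩, rfl⟩
        · rintro ⟨y, ⟨hy, hy'⟩, rfl⟩
          exact ⟨⟨y, hy, rfl⟩, by simpa using hy'⟩
      rw [this, Finset.card_image_of_injective _ τ.symm.injective]
  · simp [Finset.image_image]

lemma cover_F0 (n t : ℕ) (G : Finset (Finset ℕ)) (hG : ∀ A ∈ G, A ⊆ Finset.Icc 1 n)
    (W : Finset ℕ) (hW : W ⊆ Finset.Icc 1 n) (hc : W.card = t)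
    (h : ∀ D ∈ G, t ≤ (D ∩ W).card) : ∃ F, Iso n (F0 n t) F ∧ G ⊆ F := by
  have := iso_cover n G hG W hW t h
  rw [hc] at this
  have e : F0 n t = (Finset.Icc 1 n).powerset.filter
      (fun F => t ≤ (F ∩ Finset.Icc 1 t).card) := by
    unfold F0
    refine Finset.filter_congr fun F _ => ?_
    constructor
    · intro h; rw [Finset.inter_eq_right.2 h]; simp
    · intro h
      have : F ∩ Finset.Icc 1 t = Finset.Icc 1 t :=
        Finset.eq_of_subset_of_card_le Finset.inter_subset_right (by simpa using h)
      exact Finset.inter_eq_right.1 this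
  rw [e]; exact this

lemma cover_F1 (n t : ℕ) (G : Finset (Finset ℕ)) (hG : ∀ A ∈ G, A ⊆ Finset.Icc 1 n)
    (W : Finset ℕ) (hW : W ⊆ Finset.Icc 1 n) (hc : W.card = t + 3)
    (h : ∀ D ∈ G, t + 2 ≤ (D ∩ W).card) : ∃ F, Iso n (F1 n t) F ∧ G ⊆ F := by
  have := iso_cover n G hG W hW (t + 2) h
  rw [hc] at this
  exact this

/-! ### The case `j = 1` -/

lemma j1_small {p : ℝ} (h0 : 0 < p) (h1 : p ≤ 1 / 100) (n t : ℕ) (htp : t * p ^ 2 ≤ 2)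
    (G : Finset (Finset ℕ))
    (hG : ∀ A ∈ G, A ⊆ Finset.Icc 1 n)
    (S : Finset ℕ) (hS : S ⊆ Finset.Icc 1 n) (hSc : S.card = t + 1)
    (hint : ∀ C ∈ G, ∀ C' ∈ G, S.card ≤ (C ∩ C').card)
    (hCS : ∀ C ∈ G, t ≤ (C ∩ S).card)
    (I : Finset ℕ) (hI : I ⊆ S) (hIc : (S \ I).card ≤ 2)
    (h3 : ∀ l ∈ I, ∀ l' ∈ I, l ≠ l' → ∀ C ∈ G, ∀ C' ∈ G, C ∩ S = S \ {l} → C' ∩ S = S \ {l'} →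
      3 ≤ ((C ∩ C') \ S).card) : mu p n G ≤ p ^ t * (1 / 2) := by
  have hq : 0 < 1 - p := by linarith
  have hx0 : ∀ K, 0 ≤ hh p n G S K := fun K => PP_nonneg h0.le (by linarith) _ _
  set β := p / (1 - p) with hβ
  have hβ0 : 0 ≤ β := by positivity
  have hβ1 : β ≤ 2 * p := by
    rw [hβ, div_le_iff₀ hq]; nlinarith
  have hsing : ∀ i ∈ S, hh p n G S {i} ≤ β := by
    intro i hi
    have := hh_cross_gen h0 (by linarith) n G S hint {i} (by simpa using hi) {i} (by simpa using hi)
    simp only [Finset.union_idempotent, Finset.card_singleton, mul_one, ← sq] at this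
    exact (pow_le_pow_iff_left₀ (hx0 _) hβ0 (by norm_num)).1 this
  have hsum : ∑ i ∈ S, hh p n G S {i} ≤ 3 * β + (t + 1) * β ^ 3 := by
    rw [← Finset.sum_sdiff hI]
    have a1 : ∑ i ∈ S \ I, hh p n G S {i} ≤ 2 * β := by
      refine (Finset.sum_le_card_nsmul _ _ β fun i hi => hsing i (Finset.sdiff_subset hi)).trans ?_
      rw [nsmul_eq_mul]
      have : ((S \ I).card : ℝ) ≤ 2 := by exact_mod_cast hIc
      gcongr
    have a2 : ∑ i ∈ I, hh p n G S {i} ≤ β + (t + 1) * β ^ 3 := by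
      rcases I.eq_empty_or_nonempty with he | hne
      · rw [he, Finset.sum_empty]; positivity
      obtain ⟨i0, hi0, hmax⟩ := Finset.exists_max_image I (fun i => hh p n G S {i}) hne
      rw [← Finset.add_sum_erase _ _ hi0]
      refine add_le_add (hsing i0 (hI hi0)) ?_
      have b : ∀ i ∈ I.erase i0, hh p n G S {i} ≤ β ^ 3 := by
        intro i hi
        obtain ⟨hi1, hi2⟩ := Finset.mem_erase.1 hi
        have c1 := hh_cross h0 (by linarith) n G S {i} {i0} 3 (h3 i hi2 i0 hi0 hi1)
        have c2 : hh p n G S {i} ^ 2 ≤ (β ^ 3) ^ 2 := by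
          rw [← pow_mul, sq]
          exact (mul_le_mul_of_nonneg_left (hmax i hi2) (hx0 _)).trans c1
        exact (pow_le_pow_iff_left₀ (hx0 _) (by positivity) (by norm_num)).1 c2
      refine (Finset.sum_le_card_nsmul _ _ _ b).trans ?_
      rw [nsmul_eq_mul]
      have : ((I.erase i0).card : ℝ) ≤ t + 1 := by
        have := Finset.card_le_card ((Finset.erase_subset i0 I).trans hI)
        rw [hSc] at this
        exact_mod_cast this
      gcongr
    linarith
  rw [mu_decomp p n G hG S hS, Finset.sum_powerset]
  rw [← Finset.sum_subset (s₁ := Finset.range 2)]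
  rotate_left
  · intro k; simp; omega
  · intro k _ hk
    refine Finset.sum_eq_zero fun K hK => ?_
    obtain ⟨hK1, hK2⟩ := Finset.mem_powersetCard.1 hK
    rw [hh_zero, mul_zero]
    intro C hC e
    have := hCS C hC
    rw [e, Finset.card_sdiff_of_subset hK1] at this
    simp at hk
    have := Finset.card_le_card hK1
    omega
  rw [Finset.sum_range_succ, Finset.sum_range_one, Finset.powersetCard_zero, Finset.sum_singleton,
    Finset.powersetCard_one, Finset.sum_map]
  simp only [Finset.card_empty, pow_zero, mul_one, Nat.sub_zero, Function.Embedding.coeFn_mk,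
    Finset.card_singleton, pow_one, hSc, Nat.add_sub_cancel]
  rw [← Finset.mul_sum, pow_succ]
  have hempty : hh p n G S ∅ ≤ 1 := PP_le_one h0.le (by linarith) _ _
  have hfin : p * hh p n G S ∅ + (1 - p) * ∑ i ∈ S, hh p n G S {i} ≤ 1 / 2 := by
    have c1 : p * hh p n G S ∅ ≤ p := by nlinarith
    have c0 : 0 ≤ ∑ i ∈ S, hh p n G S {i} := Finset.sum_nonneg fun i _ => hx0 _
    have c2 : (1 - p) * ∑ i ∈ S, hh p n G S {i} ≤ 3 * β + (t + 1) * β ^ 3 := by nlinarith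
    have c3 : (t + 1) * β ^ 3 ≤ (t + 1) * (2 * p) ^ 3 := by gcongr
    have c4 : (t + 1) * (2 * p) ^ 3 = 8 * p * (t * p ^ 2 + p ^ 2) := by ring
    have c5 : 8 * p * (t * p ^ 2 + p ^ 2) ≤ 8 * p * 3 := by
      gcongr; nlinarith
    nlinarith
  have : 0 ≤ p ^ t := by positivity
  calc _ = p ^ t * (p * hh p n G S ∅ + (1 - p) * ∑ i ∈ S, hh p n G S {i}) := by ring
    _ ≤ _ := mul_le_mul_of_nonneg_left hfin this
lemma j1_main {p : ℝ} (h0 : 0 < p) (h1 : p ≤ 1 / 100) (n t : ℕ) (htp : t * p ^ 2 ≤ 2)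
    (G : Finset (Finset ℕ))
    (hG : ∀ A ∈ G, A ⊆ Finset.Icc 1 n)
    (h3w : ∀ A ∈ G, ∀ B ∈ G, ∀ C ∈ G, t ≤ (A ∩ B ∩ C).card)
    (S : Finset ℕ) (hS : S ⊆ Finset.Icc 1 n) (hSc : S.card = t + 1)
    (hint : ∀ C ∈ G, ∀ C' ∈ G, S.card ≤ (C ∩ C').card)
    (hCS : ∀ C ∈ G, t ≤ (C ∩ S).card)
    (hmu : p ^ t * (1 / 2) < mu p n G) :
    ∃ F, Iso n (F1 n t) F ∧ G ⊆ F := by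
  have hsm := j1_small h0 h1 n t htp G hG S hS hSc hint hCS
  have hex : ∃ l ∈ S, ∃ l' ∈ S, l ≠ l' ∧ ∃ C ∈ G, ∃ C' ∈ G, C ∩ S = S \ {l} ∧ C' ∩ S = S \ {l'} ∧
      ((C ∩ C') \ S).card < 3 := by
    by_contra hcon
    push Not at hcon
    exact absurd (hsm S subset_rfl (by simp) fun l hl l' hl' hne C hC C' hC' e e' =>
      hcon l hl l' hl' hne C hC C' hC' e e') (not_le.2 hmu)
  obtain ⟨l, hl, l', hl', hne, C, hC, C', hC', e, e', hlt⟩ := hex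
  set Z := (C ∩ C') \ S with hZ
  have hll : ({l, l'} : Finset ℕ) ⊆ S := by
    intro x; simp; rintro (rfl | rfl) <;> assumption
  have hCC : C ∩ C' ∩ S = S \ {l, l'} := by
    ext x
    have a := Finset.ext_iff.1 e x
    have b := Finset.ext_iff.1 e' x
    simp at a b ⊢; tauto
  have c2 : ({l, l'} : Finset ℕ).card = 2 := Finset.card_pair hne
  have c1 : (S \ {l, l'}).card + 2 = t + 1 := by
    rw [← c2, ← hSc]; exact Finset.card_sdiff_add_card_eq_card hll
  have hZc : Z.card = 2 := by
    have a1 := hint C hC C' hC'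
    have a2 := Finset.card_sdiff_add_card_inter (C ∩ C') S
    rw [hCC, ← hZ] at a2
    omega
  have hZS : Disjoint S Z := Finset.disjoint_sdiff
  have hDW : ∀ D : Finset ℕ, (D ∩ (S ∪ Z)).card = (D ∩ S).card + (D ∩ Z).card := by
    intro D
    rw [Finset.inter_union_distrib_left]
    exact Finset.card_union_of_disjoint
      (hZS.mono Finset.inter_subset_right Finset.inter_subset_right)
  have hD1 : ∀ D ∈ G, t ≤ ((S \ {l, l'}) ∩ D).card + (D ∩ Z).card := by
    intro D hD
    have a1 := h3w C hC C' hC' D hD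
    have a2 := Finset.card_sdiff_add_card_inter (C ∩ C' ∩ D) S
    have a3 : C ∩ C' ∩ D ∩ S = (S \ {l, l'}) ∩ D := by
      rw [← hCC]; ext x; simp; tauto
    have a4 : (C ∩ C' ∩ D) \ S = D ∩ Z := by
      rw [hZ]; ext x; simp; tauto
    rw [a3, a4] at a2
    omega
  have hgood : ∀ D ∈ G, ∀ i ∈ S, i ≠ l → i ≠ l' → i ∉ D → Z ⊆ D := by
    intro D hD i hi hil hil' hiD
    have a1 := hD1 D hD
    have a2 : ((S \ {l, l'}) ∩ D).card < (S \ {l, l'}).card := by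
      refine Finset.card_lt_card ⟨Finset.inter_subset_left, fun h => ?_⟩
      have : i ∈ S \ {l, l'} := by simp [hi, hil, hil']
      exact hiD (Finset.mem_inter.1 (h this)).2
    have a3 : D ∩ Z = Z :=
      Finset.eq_of_subset_of_card_le Finset.inter_subset_right (by omega)
    exact Finset.inter_eq_right.1 a3
  have hcase : ∀ D ∈ G, (∃ i ∈ S, i ∉ D) → Z ⊆ D := by
    rintro D hD ⟨i, hi, hiD⟩
    by_cases hill : i ≠ l ∧ i ≠ l'
    · exact hgood D hD i hi hill.1 hill.2 hiD
    by_contra hZD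
    obtain ⟨z, hzZ, hzD⟩ := Finset.not_subset.1 hZD
    refine absurd (hsm (S \ {l, l'}) Finset.sdiff_subset ?_ ?_) (not_le.2 hmu)
    · rw [Finset.sdiff_sdiff_eq_self hll, c2]
    intro m hm m' hm' hmm E hE E' hE' eE eE'
    simp only [Finset.mem_sdiff, Finset.mem_insert, Finset.mem_singleton, not_or] at hm hm'
    have hmE : m ∉ E := fun h => by
      have := Finset.ext_iff.1 eE m
      simp [h, hm.1] at this
    have hmE' : m' ∉ E' := fun h => by
      have := Finset.ext_iff.1 eE' m'
      simp [h, hm'.1] at this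
    have zE := hgood E hE m hm.1 hm.2.1 hm.2.2 hmE hzZ
    have zE' := hgood E' hE' m' hm'.1 hm'.2.1 hm'.2.2 hmE' hzZ
    have zS : z ∉ S := (Finset.mem_sdiff.1 hzZ).2
    have him : i ≠ m := by rintro rfl; exact hill hm.2
    have him' : i ≠ m' := by rintro rfl; exact hill hm'.2
    have a1 := h3w D hD E hE E' hE'
    have a2 := Finset.card_sdiff_add_card_inter (D ∩ E ∩ E') S
    have hsub : ({i, m, m'} : Finset ℕ) ⊆ S := by
      intro x; simp; rintro (rfl | rfl | rfl)
      · exact hi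
      · exact hm.1
      · exact hm'.1
    have a3 : ({i, m, m'} : Finset ℕ).card = 3 := Finset.card_eq_three.2
      ⟨i, m, m', him, him', hmm, rfl⟩
    have a4 := Finset.card_sdiff_add_card_eq_card hsub
    have a5 : D ∩ E ∩ E' ∩ S ⊆ S \ {i, m, m'} := by
      intro x hx
      simp only [Finset.mem_inter] at hx
      simp only [Finset.mem_sdiff, Finset.mem_insert, Finset.mem_singleton, not_or]
      refine ⟨hx.2, ?_, ?_, ?_⟩
      · rintro rfl; exact hiD hx.1.1.1
      · rintro rfl; exact hmE hx.1.1.2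
      · rintro rfl; exact hmE' hx.1.2
    have a6 := Finset.card_le_card a5
    have a7 : insert z ((D ∩ E ∩ E') \ S) ⊆ (E ∩ E') \ S := by
      intro x hx
      rw [Finset.mem_insert] at hx
      rcases hx with rfl | hx
      · simp [zE, zE', zS]
      · simp at hx ⊢; tauto
    have a8 := Finset.card_le_card a7
    rw [Finset.card_insert_of_notMem (by simp [hzD])] at a8
    omega
  refine cover_F1 n t G hG (S ∪ Z) ?_ ?_ ?_
  · refine Finset.union_subset hS ?_
    exact (Finset.sdiff_subset.trans Finset.inter_subset_left).trans (hG C hC)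
  · rw [Finset.card_union_of_disjoint hZS]; omega
  · intro D hD
    rw [hDW]
    by_cases hi : ∃ i ∈ S, i ∉ D
    · have := hCS D hD
      rw [Finset.inter_eq_right.2 (hcase D hD hi)]
      omega
    · push Not at hi
      have a1 := hD1 D hD
      have a2 : ((S \ {l, l'}) ∩ D).card ≤ (S \ {l, l'}).card :=
        Finset.card_le_card Finset.inter_subset_left
      have a3 : D ∩ S = S := Finset.inter_eq_right.2 hi
      rw [a3]; omega

lemma p0_facts (ε : ℝ) (hε : 0 < ε) : ∃ t0 : ℕ, ∀ t : ℕ, t0 < t →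
    p0 t ≤ ε ∧ ∀ p : ℝ, 0 < p → p ≤ p0 t → (t : ℝ) * p ^ 2 ≤ 1 + ε := by
  obtain ⟨N, hN⟩ := exists_nat_gt ((1 + 2 / ε) ^ 2)
  refine ⟨N, fun t ht => ?_⟩
  have htN : (N : ℝ) < t := by exact_mod_cast ht
  have ht0 : (0 : ℝ) ≤ t := by positivity
  have hs : 1 + 2 / ε ≤ Real.sqrt (4 * t + 9) := by
    apply Real.le_sqrt_of_sq_le
    linarith
  have hs2 : Real.sqrt (4 * t + 9) ^ 2 = 4 * t + 9 := Real.sq_sqrt (by positivity)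
  unfold p0
  set s := Real.sqrt (4 * t + 9) with hsdef
  have hε2 : 0 < 2 / ε := by positivity
  have hs1 : 0 < s - 1 := by linarith
  have hp0 : 2 / (s - 1) ≤ ε := by
    rw [div_le_iff₀ hs1]
    have : ε * (2 / ε) = 2 := by field_simp
    nlinarith
  refine ⟨hp0, fun p hp hpp => ?_⟩
  have e : ((t : ℝ) + 2) * (2 / (s - 1)) ^ 2 = 1 + 2 / (s - 1) := by
    have : (t : ℝ) = (s ^ 2 - 9) / 4 := by linarith
    rw [this]; field_simp; ring
  have h2 : p ^ 2 ≤ (2 / (s - 1)) ^ 2 := by gcongr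
  have h3 : (t : ℝ) * p ^ 2 ≤ (t : ℝ) * (2 / (s - 1)) ^ 2 := by gcongr
  have : 0 ≤ (2 / (s - 1)) ^ 2 := by positivity
  linarith

theorem stmt_19 (δ : ℝ) (hδ : 0 < δ) :
    ∃ t0 : ℕ, ∀ t : ℕ, t0 < t → ∀ p : ℝ, 0 < p → p ≤ p0 t →
      ∀ n : ℕ, ∀ G : Finset (Finset ℕ), (∀ A ∈ G, A ⊆ Finset.Icc 1 n) →
        RWise 3 t G → (1 / 2 + δ) * p ^ t ≤ mu p n G →
        ∃ F : Finset (Finset ℕ),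
          (Iso n (F0 n t) F ∨ Iso n (F1 n t) F) ∧ G ⊆ F := by 
  obtain ⟨ε, hε, hε1, hTT⟩ := TT_bound δ hδ
  obtain ⟨t0, ht0⟩ := p0_facts ε hε
  refine ⟨t0, ?_⟩
  intro t ht p hp hpp n G hG hR hmu
  obtain ⟨hp0, htp'⟩ := ht0 t ht
  have htp := htp' p hp hpp
  have hpε : p ≤ ε := hpp.trans hp0
  have hpt : 0 < p ^ t := by positivity
  have h3w : ∀ A ∈ G, ∀ B ∈ G, ∀ C ∈ G, t ≤ (A ∩ B ∩ C).card := by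
    intro A hA B hB C hC
    have h := hR ![A, B, C] (by intro k; fin_cases k <;> simpa)
    have e : (⋂ k, ((![A, B, C] k : Finset ℕ) : Set ℕ)) = ((A ∩ B ∩ C : Finset ℕ) : Set ℕ) := by
      ext x
      simp [Fin.forall_fin_succ, and_assoc]
    rw [e, Set.ncard_coe_finset] at h
    exact h
  have hne : G.Nonempty := by
    rw [Finset.nonempty_iff_ne_empty]
    rintro rfl
    have : 0 < (1 / 2 + δ) * p ^ t := by positivity
    simp [mu] at hmu
    linarith
  obtain ⟨⟨A, B⟩, hAB, hmin⟩ := Finset.exists_min_image (G ×ˢ G) (fun x => (x.1 ∩ x.2).card)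
    (hne.product hne)
  obtain ⟨hA, hB⟩ := Finset.mem_product.1 hAB
  simp only at hA hB
  set S := A ∩ B with hSdef
  have hS : S ⊆ Finset.Icc 1 n := Finset.inter_subset_left.trans (hG A hA)
  have hint : ∀ C ∈ G, ∀ C' ∈ G, S.card ≤ (C ∩ C').card := fun C hC C' hC' =>
    hmin (C, C') (Finset.mem_product.2 ⟨hC, hC'⟩)
  have hCS : ∀ C ∈ G, t ≤ (C ∩ S).card := by
    intro C hC
    rw [Finset.inter_comm]
    exact h3w A hA B hB C hC
  have hSt : t ≤ S.card := (hCS A hA).trans (Finset.card_le_card Finset.inter_subset_right)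
  obtain ⟨j, hj⟩ := Nat.exists_eq_add_of_le hSt
  have hlt : p ^ t * (1 / 2) < mu p n G := by nlinarith
  rcases Nat.lt_or_ge j 2 with hj2 | hj2
  · interval_cases j
    · obtain ⟨F, hF, hGF⟩ := cover_F0 n t G hG S hS hj hCS
      exact ⟨F, Or.inl hF, hGF⟩
    · obtain ⟨F, hF, hGF⟩ := j1_main hp (hpε.trans hε1) n t (by linarith) G hG h3w S hS hj hint hCS hlt
      exact ⟨F, Or.inr hF, hGF⟩
  · exfalso
    have h1 := mu_le_TT hp (by linarith) n t j G hG S hS hj hint hCS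
    have h2 := hTT p hp hpε j t hj2 htp
    have h3 := mul_lt_mul_of_pos_left h2 hpt
    linarith
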